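/- arXiv:2410.17075 — 8 statements merged into one kernel-verified Lean document; each statement's English description precedes it below -/
import Mathlib

section
/- For the sigmoid function ℓ and all real numbers x and y, ℓ̇(y)·exp(−|x − y|) ≤ ℓ̇(x) ≤ ℓ̇(y)·exp(|x − y|). -/
/-- The sigmoid (logistic) function `ℓ(x) = (1 + e^{−x})⁻¹`. -/
noncomputable def sigmoid (x : ℝ) : ℝ := (1 + Real.exp (-x))⁻¹

theorem deriv_sigmoid_eq_inv (x : ℝ) :
    deriv sigmoid x = (Real.exp x + 2 + Real.exp (-x))⁻¹ := by
  have hderiv : deriv sigmoid x = Real.sigmoid x * (1 - Real.sigmoid x) :=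
    (Real.hasDerivAt_sigmoid x).deriv
  rw [hderiv, Real.sigmoid_def, Real.exp_neg]
  have hx := Real.exp_pos x
  field_simp
  ring

theorem deriv_sigmoid_le_mul_exp_abs (x y : ℝ) :
    deriv sigmoid x ≤ deriv sigmoid y * Real.exp |x - y| := by
  have hy : Real.exp y ≤ Real.exp x * Real.exp |x - y| := by
    rw [← Real.exp_add, Real.exp_le_exp]
    linarith [neg_abs_le (x - y)]
  have hny : Real.exp (-y) ≤ Real.exp (-x) * Real.exp |x - y| := by
    rw [← Real.exp_add, Real.exp_le_exp]
    linarith [le_abs_self (x - y)]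
  have hone : 1 ≤ Real.exp |x - y| := Real.one_le_exp (abs_nonneg _)
  rw [deriv_sigmoid_eq_inv, deriv_sigmoid_eq_inv, inv_mul_eq_div,
    inv_le_iff_one_le_mul₀ (by positivity), div_mul_eq_mul_div, one_le_div (by positivity)]
  linarith

/-- `ℓ̇(y)·exp(−|x−y|) ≤ ℓ̇(x) ≤ ℓ̇(y)·exp(|x−y|)` for all reals `x, y`. -/
theorem sigmoid_deriv_exp_control (x y : ℝ) :
    deriv sigmoid y * Real.exp (-|x - y|) ≤ deriv sigmoid x ∧
      deriv sigmoid x ≤ deriv sigmoid y * Real.exp |x - y| := by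
  refine ⟨?_, deriv_sigmoid_le_mul_exp_abs x y⟩
  rw [Real.exp_neg, ← div_eq_mul_inv, div_le_iff₀ (Real.exp_pos _), abs_sub_comm]
  exact deriv_sigmoid_le_mul_exp_abs y x
end

section
/- For all vectors x, θ₁, θ₂ ∈ ℝ^d and for each θ ∈ {θ₁, θ₂}, the bound α(x, θ₁, θ₂) ≥ ℓ̇(xᵀθ) / (1 + |xᵀ(θ₁ − θ₂)|) holds. -/
open Matrix

/-- `α(x, θ₁, θ₂) := ∫₀¹ ℓ̇(v·xᵀθ₂ + (1−v)·xᵀθ₁) dv`. -/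
noncomputable def alphaCoeff {d : ℕ} (x θ₁ θ₂ : Fin d → ℝ) : ℝ :=
  ∫ v in (0:ℝ)..1, deriv sigmoid (v * (x ⬝ᵥ θ₂) + (1 - v) * (x ⬝ᵥ θ₁))

theorem deriv_sigmoid_eq (x : ℝ) :
    deriv sigmoid x = (2 + Real.exp x + Real.exp (-x))⁻¹ := by
  have hpos : 0 < 1 + Real.exp (-x) := by positivity
  have h : HasDerivAt sigmoid (-(Real.exp (-x) * -1) / (1 + Real.exp (-x)) ^ 2) x :=
    ((hasDerivAt_neg x).exp.const_add 1).fun_inv hpos.ne'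
  rw [h.deriv, Real.exp_neg]
  have := Real.exp_pos x
  field_simp
  ring

theorem continuous_deriv_sigmoid : Continuous (deriv sigmoid) := by
  rw [funext deriv_sigmoid_eq]
  exact Continuous.inv₀ (by fun_prop) fun x => by positivity

/-- Multiplicative form of the self-concordance of the logistic function. -/
theorem exp_neg_abs_sub_mul_deriv_sigmoid_le (a b : ℝ) :
    Real.exp (-|b - a|) * deriv sigmoid a ≤ deriv sigmoid b := by
  have one_le : 1 ≤ Real.exp |b - a| := Real.one_le_exp (abs_nonneg _)
  have exp_le : Real.exp b ≤ Real.exp |b - a| * Real.exp a := by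
    rw [← Real.exp_add]
    exact Real.exp_le_exp.2 (by linarith [le_abs_self (b - a)])
  have exp_neg_le : Real.exp (-b) ≤ Real.exp |b - a| * Real.exp (-a) := by
    rw [← Real.exp_add]
    exact Real.exp_le_exp.2 (by linarith [neg_abs_le (b - a)])
  rw [deriv_sigmoid_eq, deriv_sigmoid_eq, Real.exp_neg, ← mul_inv]
  exact inv_anti₀ (by positivity) (by linarith)

theorem inv_one_add_le_integral_exp_neg_mul {c : ℝ} (hc : 0 ≤ c) :
    (1 + c)⁻¹ ≤ ∫ v in (0 : ℝ)..1, Real.exp (-(v * c)) := by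
  have integral_eq : ∫ v in (0 : ℝ)..1, c * Real.exp (-(v * c)) = 1 - Real.exp (-c) := by
    have hderiv (v : ℝ) :
        HasDerivAt (fun v => -Real.exp (-(v * c))) (c * Real.exp (-(v * c))) v :=
      ((hasDerivAt_mul_const c).fun_neg.exp.fun_neg).congr_deriv (by ring)
    rw [intervalIntegral.integral_eq_sub_of_hasDerivAt (fun v _ => hderiv v)
      (Continuous.intervalIntegrable (by fun_prop) _ _)]
    simp
    ring
  have exp_le : Real.exp (-c) ≤ ∫ v in (0 : ℝ)..1, Real.exp (-(v * c)) := by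
    have := intervalIntegral.integral_mono_on (μ := MeasureTheory.volume) (zero_le_one' ℝ)
      (f := fun _ => Real.exp (-c)) (g := fun v => Real.exp (-(v * c)))
      (by simp) (Continuous.intervalIntegrable (by fun_prop) _ _)
      fun v hv => Real.exp_le_exp.2 (neg_le_neg (mul_le_of_le_one_left hc hv.2))
    simpa using this
  rw [intervalIntegral.integral_const_mul] at integral_eq
  rw [inv_le_iff_one_le_mul₀ (by positivity)]
  linarith

theorem deriv_sigmoid_div_le_integral (a b : ℝ) :
    deriv sigmoid a / (1 + |a - b|) ≤
      ∫ v in (0 : ℝ)..1, deriv sigmoid (v * b + (1 - v) * a) := by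
  have deriv_nonneg : 0 ≤ deriv sigmoid a := by rw [deriv_sigmoid_eq]; positivity
  calc deriv sigmoid a / (1 + |a - b|)
      ≤ (∫ v in (0 : ℝ)..1, Real.exp (-(v * |a - b|))) * deriv sigmoid a := by
        rw [div_eq_inv_mul]
        gcongr
        exact inv_one_add_le_integral_exp_neg_mul (abs_nonneg _)
    _ = ∫ v in (0 : ℝ)..1, Real.exp (-(v * |a - b|)) * deriv sigmoid a :=
        (intervalIntegral.integral_mul_const _ _).symm
    _ ≤ ∫ v in (0 : ℝ)..1, deriv sigmoid (v * b + (1 - v) * a) := by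
        refine intervalIntegral.integral_mono_on zero_le_one
          (Continuous.intervalIntegrable (by fun_prop) _ _)
          ((continuous_deriv_sigmoid.comp (by fun_prop)).intervalIntegrable _ _) fun v hv => ?_
        have habs : |v * b + (1 - v) * a - a| = v * |a - b| := by
          rw [show v * b + (1 - v) * a - a = v * (b - a) by ring, abs_mul, abs_of_nonneg hv.1,
            abs_sub_comm]
        simpa only [habs] using exp_neg_abs_sub_mul_deriv_sigmoid_le a (v * b + (1 - v) * a)

theorem alphaCoeff_comm {d : ℕ} (x θ₁ θ₂ : Fin d → ℝ) :
    alphaCoeff x θ₁ θ₂ = alphaCoeff x θ₂ θ₁ := by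
  have := intervalIntegral.integral_comp_sub_left (a := 0) (b := 1)
    (fun v : ℝ => deriv sigmoid (v * (x ⬝ᵥ θ₁) + (1 - v) * (x ⬝ᵥ θ₂))) 1
  simpa [alphaCoeff, add_comm] using this

/-- Self-concordance control of `α`: for each `θ ∈ {θ₁, θ₂}`,
`α(x,θ₁,θ₂) ≥ ℓ̇(xᵀθ)/(1 + |xᵀ(θ₁−θ₂)|)`. -/
theorem alphaCoeff_lower_bound {d : ℕ} (x θ₁ θ₂ : Fin d → ℝ) :
    ∀ θ ∈ ({θ₁, θ₂} : Set (Fin d → ℝ)),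
      deriv sigmoid (x ⬝ᵥ θ) / (1 + |x ⬝ᵥ (θ₁ - θ₂)|) ≤ alphaCoeff x θ₁ θ₂ := by
  rintro θ (rfl | rfl)
  · rw [dotProduct_sub]
    exact deriv_sigmoid_div_le_integral _ _
  · rw [alphaCoeff_comm, dotProduct_sub, abs_sub_comm]
    exact deriv_sigmoid_div_le_integral _ _
end

section
/- Let H be a d×d symmetric positive definite real matrix. For all vectors x, θ₁, θ₂ ∈ ℝ^d, |ℓ(θ₁ᵀx) − ℓ(θ₂ᵀx)| ≤ ℓ̇(θ₂ᵀx)·‖x‖_{H⁻¹}·‖θ₁ − θ₂‖_H + (1/8)·‖x‖²_{H⁻¹}·‖θ₁ − θ₂‖²_H. -/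
open Matrix

/-- A lower bound on the second derivative gives a quadratic lower bound around any point. -/
theorem quadratic_lower_bound_of_hasDerivAt {f f' f'' : ℝ → ℝ} {C : ℝ}
    (hf : ∀ y, HasDerivAt f (f' y) y) (hf' : ∀ y, HasDerivAt f' (f'' y) y)
    (hC : ∀ y, -C ≤ f'' y) (a b : ℝ) :
    f a + f' a * (b - a) - C / 2 * (b - a) ^ 2 ≤ f b := by
  have h1 (y : ℝ) : HasDerivAt (fun y ↦ f y + C / 2 * y ^ 2) (f' y + C * y) y := by
    convert! (hf y).add ((hasDerivAt_pow 2 y).const_mul (C / 2)) using 1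
    ring
  have h2 (y : ℝ) : HasDerivAt (fun y ↦ f' y + C * y) (f'' y + C) y := by
    convert! (hf' y).add ((hasDerivAt_id y).const_mul C) using 1
    ring
  have hmono : Monotone (fun y ↦ f' y + C * y) :=
    monotone_of_deriv_nonneg (fun y ↦ (h2 y).differentiableAt) fun y ↦ by
      rw [(h2 y).deriv]
      linarith [hC y]
  have hconv : ConvexOn ℝ Set.univ (fun y ↦ f y + C / 2 * y ^ 2) := by
    refine Monotone.convexOn_univ_of_deriv (fun y ↦ (h1 y).differentiableAt) ?_
    rwa [funext fun y ↦ (h1 y).deriv]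
  rcases lt_trichotomy a b with hab | rfl | hab
  · have h := hconv.le_slope_of_hasDerivAt (Set.mem_univ a) (Set.mem_univ b) hab (h1 a)
    rw [slope_def_field, le_div_iff₀ (sub_pos.2 hab)] at h
    linarith
  · simp
  · have h := hconv.slope_le_of_hasDerivAt (Set.mem_univ b) (Set.mem_univ a) hab (h1 a)
    rw [slope_def_field, div_le_iff₀ (sub_pos.2 hab)] at h
    linarith

/-- First-order expansion of the sigmoid, with remainder controlled by `|ℓ̈| ≤ 1 / 4`. -/
theorem Real.abs_sigmoid_sub_le (a b : ℝ) :
    |Real.sigmoid b - Real.sigmoid a| ≤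
      Real.sigmoid a * (1 - Real.sigmoid a) * |b - a| + 1 / 8 * (b - a) ^ 2 := by
  have h1 (y : ℝ) := Real.hasDerivAt_sigmoid y
  have h2 (y : ℝ) := (h1 y).mul ((h1 y).const_sub 1)
  have hp (y : ℝ) := Real.sigmoid_pos y
  have hq (y : ℝ) := Real.sigmoid_lt_one y
  have hbound (y : ℝ) : |Real.sigmoid y * (1 - Real.sigmoid y) * (1 - Real.sigmoid y) +
      Real.sigmoid y * -(Real.sigmoid y * (1 - Real.sigmoid y))| ≤ 1 / 4 := by
    have hpq : 0 < Real.sigmoid y * (1 - Real.sigmoid y) := mul_pos (hp y) (sub_pos.2 (hq y))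
    have hpq' : Real.sigmoid y * (1 - Real.sigmoid y) ≤ 1 / 4 := by
      nlinarith [sq_nonneg (Real.sigmoid y - 1 / 2)]
    rw [abs_le]
    constructor <;> nlinarith [hp y, hq y, mul_pos hpq (hp y), mul_pos hpq (sub_pos.2 (hq y))]
  have hlow := quadratic_lower_bound_of_hasDerivAt (C := 1 / 4) h1 h2
    (fun y ↦ (abs_le.1 (hbound y)).1) a b
  have hupp := quadratic_lower_bound_of_hasDerivAt (C := 1 / 4) (fun y ↦ (h1 y).neg)
    (fun y ↦ (h2 y).neg) (fun y ↦ neg_le_neg (abs_le.1 (hbound y)).2) a b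
  simp only [Pi.neg_apply] at hlow hupp
  have hpq : 0 ≤ Real.sigmoid a * (1 - Real.sigmoid a) :=
    mul_nonneg (hp a).le (sub_nonneg.2 (hq a).le)
  have hle := mul_le_mul_of_nonneg_left (le_abs_self (b - a)) hpq
  have hge := mul_le_mul_of_nonneg_left (neg_abs_le (b - a)) hpq
  rw [abs_le]
  constructor <;> linarith

/-- The Cauchy–Schwarz inequality for the dual norms given by `H` and `H⁻¹`. -/
theorem Matrix.PosDef.dotProduct_sq_le {n : Type*} [Fintype n] [DecidableEq n]
    {H : Matrix n n ℝ} (hH : H.PosDef) (u x : n → ℝ) :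
    (u ⬝ᵥ x) ^ 2 ≤ (x ⬝ᵥ (H⁻¹ *ᵥ x)) * (u ⬝ᵥ (H *ᵥ u)) := by
  have hx : H *ᵥ (H⁻¹ *ᵥ x) = x := by
    rw [mulVec_mulVec, mul_nonsing_inv _ ((isUnit_iff_isUnit_det H).1 hH.isUnit), one_mulVec]
  have hsymm (v w : n → ℝ) : v ⬝ᵥ (H *ᵥ w) = w ⬝ᵥ (H *ᵥ v) := by
    have ht : Hᵀ = H := by simpa using hH.isHermitian.eq
    rw [← dotProduct_transpose_mulVec, ht]
  have h := LinearMap.BilinForm.apply_mul_apply_le_of_forall_zero_le (Matrix.toBilin' H)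
    (fun v ↦ by simpa [Matrix.toBilin'_apply'] using hH.posSemidef.dotProduct_mulVec_nonneg v)
    u (H⁻¹ *ᵥ x)
  simp only [Matrix.toBilin'_apply', hsymm (H⁻¹ *ᵥ x) u, hx] at h
  rw [dotProduct_comm (H⁻¹ *ᵥ x) x] at h
  linarith

/-- For a symmetric positive definite `H`,
`|ℓ(θ₁ᵀx) − ℓ(θ₂ᵀx)| ≤ ℓ̇(θ₂ᵀx)·‖x‖_{H⁻¹}·‖θ₁−θ₂‖_H + (1/8)·‖x‖²_{H⁻¹}·‖θ₁−θ₂‖²_H`,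
where `‖y‖_M := √(yᵀ M y)` (so `‖y‖²_M = yᵀ M y`). -/
theorem variance_adaptive_bonus_core {d : ℕ} (H : Matrix (Fin d) (Fin d) ℝ)
    (hH : H.PosDef) (x θ₁ θ₂ : Fin d → ℝ) :
    |sigmoid (θ₁ ⬝ᵥ x) - sigmoid (θ₂ ⬝ᵥ x)| ≤
      deriv sigmoid (θ₂ ⬝ᵥ x) * Real.sqrt (x ⬝ᵥ (H⁻¹ *ᵥ x)) *
          Real.sqrt ((θ₁ - θ₂) ⬝ᵥ (H *ᵥ (θ₁ - θ₂))) +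
        (1 / 8) * (x ⬝ᵥ (H⁻¹ *ᵥ x)) * ((θ₁ - θ₂) ⬝ᵥ (H *ᵥ (θ₁ - θ₂))) := by
  have hA : 0 ≤ x ⬝ᵥ (H⁻¹ *ᵥ x) := by
    simpa using hH.inv.posSemidef.dotProduct_mulVec_nonneg x
  have hcs := hH.dotProduct_sq_le (θ₁ - θ₂) x
  have habs := Real.abs_le_sqrt hcs
  rw [Real.sqrt_mul hA] at habs
  have h := Real.abs_sigmoid_sub_le (θ₂ ⬝ᵥ x) (θ₁ ⬝ᵥ x)
  rw [← sub_dotProduct] at h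
  have hpq : 0 ≤ Real.sigmoid (θ₂ ⬝ᵥ x) * (1 - Real.sigmoid (θ₂ ⬝ᵥ x)) :=
    mul_nonneg (Real.sigmoid_nonneg _) (sub_nonneg.2 (Real.sigmoid_le_one _))
  have hmul := mul_le_mul_of_nonneg_left habs hpq
  rw [show sigmoid = Real.sigmoid from rfl, (Real.hasDerivAt_sigmoid _).deriv]
  linarith
end

section
/- Let φ₁, …, φₙ ∈ ℝ^d with ‖φⱼ‖₂ ≤ 1 for all j, let λ > 0, and let θ₁, θ₂ ∈ ℝ^d. Define G := Σⱼ α(φⱼ, θ₁, θ₂)·φⱼφⱼᵀ + λ·I_d and H(θ₁) := Σⱼ ℓ̇(φⱼᵀθ₁)·φⱼφⱼᵀ + λ·I_d. Then (1 + λ^{−1/2}·‖θ₁ − θ₂‖_G)·G ⪰ H(θ₁). -/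
open Matrix

/-- `G := Σⱼ α(φⱼ, θ₁, θ₂)·φⱼφⱼᵀ + λ·I`. -/
noncomputable def Gmat {d n : ℕ} (φ : Fin n → Fin d → ℝ) (lam : ℝ)
    (θ₁ θ₂ : Fin d → ℝ) : Matrix (Fin d) (Fin d) ℝ :=
  (∑ j, alphaCoeff (φ j) θ₁ θ₂ • Matrix.vecMulVec (φ j) (φ j)) + lam • 1

/-- `H(θ₁) := Σⱼ ℓ̇(φⱼᵀθ₁)·φⱼφⱼᵀ + λ·I`. -/
noncomputable def Hmat {d n : ℕ} (φ : Fin n → Fin d → ℝ) (lam : ℝ)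
    (θ : Fin d → ℝ) : Matrix (Fin d) (Fin d) ℝ :=
  (∑ j, deriv sigmoid (φ j ⬝ᵥ θ) • Matrix.vecMulVec (φ j) (φ j)) + lam • 1

theorem deriv_sigmoid (x : ℝ) :
    deriv sigmoid x = Real.exp (-x) / (1 + Real.exp (-x)) ^ 2 := by
  have hpos : 1 + Real.exp (-x) ≠ 0 := by positivity
  have h : HasDerivAt (fun y : ℝ => (1 + Real.exp (-y))⁻¹)
      (-(Real.exp (-x) * (-1)) / (1 + Real.exp (-x)) ^ 2) x :=
    (((hasDerivAt_neg x).exp).const_add 1).inv hpos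
  have h' : deriv sigmoid x = _ := h.deriv
  rw [h']
  ring

theorem deriv_sigmoid_nonneg (x : ℝ) : 0 ≤ deriv sigmoid x := by
  rw [deriv_sigmoid]
  positivity

/-- Self-concordance of the sigmoid. -/
theorem deriv_sigmoid_mul_exp_neg_abs_le (a t : ℝ) :
    deriv sigmoid a * Real.exp (-|t|) ≤ deriv sigmoid (a + t) := by
  rw [deriv_sigmoid, deriv_sigmoid, neg_add, Real.exp_add]
  have hp := Real.exp_pos (-a)
  have hs := Real.exp_pos (-t)
  set p := Real.exp (-a)
  rw [div_mul_eq_mul_div, div_le_div_iff₀ (by positivity) (by positivity)]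
  rcases le_total 0 t with ht | ht
  · rw [abs_of_nonneg ht]
    have hs1 : Real.exp (-t) ≤ 1 := Real.exp_le_one_iff.2 (by linarith)
    gcongr
    nlinarith
  · rw [abs_of_nonpos ht, neg_neg]
    have hs1 : 1 ≤ Real.exp (-t) := Real.one_le_exp (by linarith)
    have hm : Real.exp t * Real.exp (-t) = 1 := by rw [← Real.exp_add]; simp
    have hm0 := Real.exp_pos t
    set s := Real.exp (-t)
    have h1 : (1 + p * s) ^ 2 ≤ (s * (1 + p)) ^ 2 := by
      gcongr
      nlinarith
    calc p * Real.exp t * (1 + p * s) ^ 2 ≤ p * Real.exp t * (s * (1 + p)) ^ 2 := by gcongr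
      _ = p * (Real.exp t * s) * s * (1 + p) ^ 2 := by ring
      _ = p * s * (1 + p) ^ 2 := by rw [hm]; ring

theorem one_le_one_add_mul_integral_exp_neg_mul {D : ℝ} (hD : 0 ≤ D) :
    1 ≤ (1 + D) * ∫ v in (0:ℝ)..1, Real.exp (-(v * D)) := by
  have hcont : Continuous fun v : ℝ => Real.exp (-(v * D)) := by fun_prop
  have hderiv : ∀ v ∈ Set.uIcc (0:ℝ) 1,
      HasDerivAt (fun v : ℝ => -Real.exp (-(v * D))) (D * Real.exp (-(v * D))) v := by
    intro v _
    have h : HasDerivAt (fun v : ℝ => -Real.exp (-(v * D)))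
        (-(Real.exp (-(v * D)) * -(1 * D))) v :=
      (((hasDerivAt_id v).mul_const D).neg.exp).neg
    exact h.congr_deriv (by ring)
  have hftc := intervalIntegral.integral_eq_sub_of_hasDerivAt hderiv
    ((continuous_const.mul hcont).intervalIntegrable 0 1)
  rw [intervalIntegral.integral_const_mul] at hftc
  have hmono : ∫ _ in (0:ℝ)..1, Real.exp (-D) ≤ ∫ v in (0:ℝ)..1, Real.exp (-(v * D)) := by
    refine intervalIntegral.integral_mono_on zero_le_one
      (continuous_const.intervalIntegrable 0 1) (hcont.intervalIntegrable 0 1) fun v hv => ?_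
    refine Real.exp_le_exp.2 ?_
    nlinarith [hv.2]
  simp only [zero_mul, one_mul, neg_zero, Real.exp_zero] at hftc
  simp only [intervalIntegral.integral_const, sub_zero, one_smul] at hmono
  linarith

theorem alphaCoeff_nonneg {d : ℕ} (x θ₁ θ₂ : Fin d → ℝ) : 0 ≤ alphaCoeff x θ₁ θ₂ :=
  intervalIntegral.integral_nonneg zero_le_one fun _ _ => deriv_sigmoid_nonneg _

theorem deriv_sigmoid_le_one_add_abs_mul_alphaCoeff {d : ℕ} (x θ₁ θ₂ : Fin d → ℝ) :
    deriv sigmoid (x ⬝ᵥ θ₁) ≤ (1 + |x ⬝ᵥ (θ₁ - θ₂)|) * alphaCoeff x θ₁ θ₂ := by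
  set D := |x ⬝ᵥ (θ₁ - θ₂)| with hDdef
  have hD : 0 ≤ D := abs_nonneg _
  have hle : deriv sigmoid (x ⬝ᵥ θ₁) * ∫ v in (0:ℝ)..1, Real.exp (-(v * D)) ≤
      alphaCoeff x θ₁ θ₂ := by
    rw [← intervalIntegral.integral_const_mul]
    have hcont : Continuous fun v : ℝ =>
        deriv sigmoid (v * (x ⬝ᵥ θ₂) + (1 - v) * (x ⬝ᵥ θ₁)) :=
      continuous_deriv_sigmoid.comp (by fun_prop)
    refine intervalIntegral.integral_mono_on zero_le_one
      (Continuous.intervalIntegrable (by fun_prop) 0 1) (hcont.intervalIntegrable 0 1)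
      fun v hv => ?_
    have h := deriv_sigmoid_mul_exp_neg_abs_le (x ⬝ᵥ θ₁) (-(v * (x ⬝ᵥ (θ₁ - θ₂))))
    rw [abs_neg, abs_mul, abs_of_nonneg hv.1, ← hDdef] at h
    refine h.trans_eq (congrArg _ ?_)
    rw [dotProduct_sub]
    ring
  calc deriv sigmoid (x ⬝ᵥ θ₁)
      ≤ deriv sigmoid (x ⬝ᵥ θ₁) * ((1 + D) * ∫ v in (0:ℝ)..1, Real.exp (-(v * D))) :=
        le_mul_of_one_le_right (deriv_sigmoid_nonneg _)
          (one_le_one_add_mul_integral_exp_neg_mul hD)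
    _ = (1 + D) * (deriv sigmoid (x ⬝ᵥ θ₁) * ∫ v in (0:ℝ)..1, Real.exp (-(v * D))) := by ring
    _ ≤ (1 + D) * alphaCoeff x θ₁ θ₂ := by gcongr

theorem posSemidef_vecMulVec_self_real {d : ℕ} (x : Fin d → ℝ) :
    (Matrix.vecMulVec x x).PosSemidef := by
  simpa using Matrix.posSemidef_vecMulVec_self_star x

theorem mul_dotProduct_self_le_Gmat {d n : ℕ} (φ : Fin n → Fin d → ℝ) (lam : ℝ)
    (θ₁ θ₂ y : Fin d → ℝ) :
    lam * (y ⬝ᵥ y) ≤ y ⬝ᵥ (Gmat φ lam θ₁ θ₂ *ᵥ y) := by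
  have hS : (∑ j, alphaCoeff (φ j) θ₁ θ₂ • Matrix.vecMulVec (φ j) (φ j)).PosSemidef :=
    Matrix.posSemidef_sum _ fun j _ =>
      (posSemidef_vecMulVec_self_real (φ j)).smul (alphaCoeff_nonneg _ _ _)
  have h := hS.dotProduct_mulVec_nonneg y
  rw [star_trivial] at h
  rw [Gmat, Matrix.add_mulVec, dotProduct_add, Matrix.smul_mulVec, Matrix.one_mulVec,
    dotProduct_smul, smul_eq_mul]
  linarith

theorem abs_dotProduct_le_sqrt_of_sqrt_le_one {d : ℕ} {x : Fin d → ℝ}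
    (hx : Real.sqrt (x ⬝ᵥ x) ≤ 1) (y : Fin d → ℝ) :
    |x ⬝ᵥ y| ≤ Real.sqrt (y ⬝ᵥ y) := by
  have hx1 : x ⬝ᵥ x ≤ 1 := by simpa using Real.sqrt_le_iff.1 hx
  have hy : 0 ≤ y ⬝ᵥ y := Finset.sum_nonneg fun i _ => mul_self_nonneg (y i)
  refine Real.abs_le_sqrt ?_
  have hcs : (x ⬝ᵥ y) ^ 2 ≤ (x ⬝ᵥ x) * (y ⬝ᵥ y) := by
    have h := Finset.sum_mul_sq_le_sq_mul_sq Finset.univ x y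
    simpa only [dotProduct, sq] using h
  nlinarith

/-- Self-bounding matrix inequality:
`(1 + λ^{−1/2}·‖θ₁ − θ₂‖_G)·G ⪰ H(θ₁)`, where `‖y‖_G := √(yᵀ G y)`. -/
theorem G_self_bounding {d n : ℕ} (φ : Fin n → Fin d → ℝ)
    (hφ : ∀ j, Real.sqrt (φ j ⬝ᵥ φ j) ≤ 1)
    (lam : ℝ) (hlam : 0 < lam) (θ₁ θ₂ : Fin d → ℝ) :
    ((1 + (Real.sqrt lam)⁻¹ *
          Real.sqrt ((θ₁ - θ₂) ⬝ᵥ (Gmat φ lam θ₁ θ₂ *ᵥ (θ₁ - θ₂)))) •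
        Gmat φ lam θ₁ θ₂ - Hmat φ lam θ₁).PosSemidef := by
  set C := (Real.sqrt lam)⁻¹ *
    Real.sqrt ((θ₁ - θ₂) ⬝ᵥ (Gmat φ lam θ₁ θ₂ *ᵥ (θ₁ - θ₂))) with hC
  have hC0 : 0 ≤ C := by positivity
  have hnorm : Real.sqrt ((θ₁ - θ₂) ⬝ᵥ (θ₁ - θ₂)) ≤ C := by
    rw [hC, le_inv_mul_iff₀ (Real.sqrt_pos.2 hlam), ← Real.sqrt_mul hlam.le]
    exact Real.sqrt_le_sqrt (mul_dotProduct_self_le_Gmat φ lam θ₁ θ₂ _)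
  have hcoef : ∀ j, 0 ≤ (1 + C) * alphaCoeff (φ j) θ₁ θ₂ - deriv sigmoid (φ j ⬝ᵥ θ₁) := by
    intro j
    have h1 := deriv_sigmoid_le_one_add_abs_mul_alphaCoeff (φ j) θ₁ θ₂
    have h2 := (abs_dotProduct_le_sqrt_of_sqrt_le_one (hφ j) (θ₁ - θ₂)).trans hnorm
    have h3 := mul_le_mul_of_nonneg_right h2 (alphaCoeff_nonneg (φ j) θ₁ θ₂)
    linarith
  have hdecomp : (1 + C) • Gmat φ lam θ₁ θ₂ - Hmat φ lam θ₁ =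
      (∑ j, ((1 + C) * alphaCoeff (φ j) θ₁ θ₂ - deriv sigmoid (φ j ⬝ᵥ θ₁)) •
        Matrix.vecMulVec (φ j) (φ j)) + (C * lam) • (1 : Matrix (Fin d) (Fin d) ℝ) := by
    simp only [Gmat, Hmat, sub_smul, Finset.sum_sub_distrib, mul_smul, ← Finset.smul_sum]
    module
  rw [hdecomp]
  exact (Matrix.posSemidef_sum _ fun j _ =>
    (posSemidef_vecMulVec_self_real (φ j)).smul (hcoef j)).add
      (Matrix.PosSemidef.one.smul (mul_nonneg hC0 hlam.le))
end

section
/- Let φ₁, …, φₙ ∈ ℝ^d, let λ > 0, let D ≥ 0, and let θ₁, θ₂ ∈ ℝ^d satisfy |φⱼᵀ(θ₁ − θ₂)| ≤ D for all j. Then H(θ₁) ⪯ e^D·H(θ₂), where H(θ) := Σⱼ ℓ̇(φⱼᵀθ)·φⱼφⱼᵀ + λ·I_d. -/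
open Matrix

theorem deriv_sigmoid_le_exp_mul {x y D : ℝ} (h : |x - y| ≤ D) :
    deriv sigmoid x ≤ Real.exp D * deriv sigmoid y := by
  obtain ⟨hl, hu⟩ := abs_le.mp h
  have hD : 1 ≤ Real.exp D := Real.one_le_exp ((abs_nonneg _).trans h)
  have h1 : Real.exp y ≤ Real.exp D * Real.exp x := by
    rw [← Real.exp_add]
    exact Real.exp_le_exp.mpr (by linarith)
  have h2 : Real.exp (-y) ≤ Real.exp D * Real.exp (-x) := by
    rw [← Real.exp_add]
    exact Real.exp_le_exp.mpr (by linarith)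
  rw [deriv_sigmoid_eq, deriv_sigmoid_eq, ← div_eq_mul_inv, inv_eq_one_div,
    div_le_div_iff₀ (by positivity) (by positivity)]
  linarith

/-- If `|φⱼᵀ(θ₁ − θ₂)| ≤ D` for all `j`, then `H(θ₁) ⪯ e^D·H(θ₂)`,
i.e. `e^D·H(θ₂) − H(θ₁)` is positive semidefinite. -/
theorem hessian_comparison {d n : ℕ} (φ : Fin n → Fin d → ℝ) (lam : ℝ)
    (hlam : 0 < lam) (D : ℝ) (hD : 0 ≤ D) (θ₁ θ₂ : Fin d → ℝ)
    (h : ∀ j, |φ j ⬝ᵥ (θ₁ - θ₂)| ≤ D) :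
    (Real.exp D • Hmat φ lam θ₂ - Hmat φ lam θ₁).PosSemidef := by
  have heq : Real.exp D • Hmat φ lam θ₂ - Hmat φ lam θ₁ =
      (∑ j, (Real.exp D * deriv sigmoid (φ j ⬝ᵥ θ₂) - deriv sigmoid (φ j ⬝ᵥ θ₁)) •
        Matrix.vecMulVec (φ j) (φ j)) + ((Real.exp D - 1) * lam) • 1 := by
    simp only [Hmat, sub_smul, mul_smul, Finset.sum_sub_distrib, smul_add, Finset.smul_sum,
      sub_mul, one_mul]
    abel
  rw [heq]
  refine .add (Matrix.posSemidef_sum _ fun j _ => .smul ?_ ?_) (.smul .one ?_)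
  · simpa using Matrix.posSemidef_vecMulVec_self_star (φ j)
  · exact sub_nonneg.mpr (deriv_sigmoid_le_exp_mul (by simpa [dotProduct_sub] using h j))
  · exact mul_nonneg (sub_nonneg.mpr (Real.one_le_exp hD)) hlam.le
end

section
/- Let d ≥ 1 and let x₁, …, x_t ∈ ℝ^d be a sequence of vectors with ‖xᵢ‖₂ ≤ L for all 1 ≤ i ≤ t, and let λ > 0. Then det(λ·I_d + Σ_{i=1}^t xᵢxᵢᵀ) ≤ (λ + t·L²/d)^d. -/
open Matrix

/-- AM-GM for the eigenvalues of a positive semidefinite real matrix. -/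
theorem Matrix.PosSemidef.det_le_trace_div_card_pow {n : Type*} [Fintype n] [DecidableEq n]
    [Nonempty n] {A : Matrix n n ℝ} (hA : A.PosSemidef) :
    A.det ≤ (A.trace / Fintype.card n) ^ Fintype.card n := by
  have hcard : (Fintype.card n : ℝ) ≠ 0 := by exact_mod_cast Fintype.card_ne_zero
  have hev := hA.eigenvalues_nonneg
  have amgm := Real.geom_mean_le_arith_mean_weighted Finset.univ
    (fun _ : n => (Fintype.card n : ℝ)⁻¹) hA.isHermitian.eigenvalues
    (fun _ _ => by positivity) (by simp [hcard]) (fun i _ => hev i)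
  rw [Real.finsetProd_rpow _ _ (fun i _ => hev i), ← Finset.mul_sum] at amgm
  have hprod : 0 ≤ ∏ i, hA.isHermitian.eigenvalues i := Finset.prod_nonneg fun i _ => hev i
  have hpow := pow_le_pow_left₀ (Real.rpow_nonneg hprod _) amgm (Fintype.card n)
  rw [Real.rpow_inv_natCast_pow hprod Fintype.card_ne_zero, inv_mul_eq_div] at hpow
  simpa [hA.isHermitian.det_eq_prod_eigenvalues, hA.isHermitian.trace_eq_sum_eigenvalues]
    using hpow

/-- Determinant–trace inequality: if `‖xᵢ‖₂ ≤ L` for `i = 1, …, t` and `λ > 0`,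
then `det(λ·I + Σᵢ xᵢxᵢᵀ) ≤ (λ + t·L²/d)^d`. -/
theorem det_trace_inequality {d t : ℕ} (hd : 1 ≤ d) (L : ℝ) (lam : ℝ)
    (hlam : 0 < lam) (x : Fin t → Fin d → ℝ)
    (hx : ∀ i, Real.sqrt (x i ⬝ᵥ x i) ≤ L) :
    (lam • (1 : Matrix (Fin d) (Fin d) ℝ) +
        ∑ i, Matrix.vecMulVec (x i) (x i)).det ≤
      (lam + t * L ^ 2 / d) ^ d := by
  have hpsd : (lam • (1 : Matrix (Fin d) (Fin d) ℝ) +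
      ∑ i, Matrix.vecMulVec (x i) (x i)).PosSemidef := by
    refine (Matrix.PosSemidef.one.smul hlam.le).add
      (Matrix.posSemidef_sum _ fun i _ => ?_)
    simpa using Matrix.posSemidef_vecMulVec_self_star (x i)
  have : Nonempty (Fin d) := ⟨⟨0, hd⟩⟩
  have hd0 : (0 : ℝ) < d := by exact_mod_cast hd
  have hsum : ∑ i, x i ⬝ᵥ x i ≤ t * L ^ 2 := by
    calc ∑ i, x i ⬝ᵥ x i ≤ ∑ _i : Fin t, L ^ 2 :=
          Finset.sum_le_sum fun i _ => (Real.sqrt_le_iff.mp (hx i)).2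
      _ = t * L ^ 2 := by simp
  have htrace : (lam • (1 : Matrix (Fin d) (Fin d) ℝ) +
      ∑ i, Matrix.vecMulVec (x i) (x i)).trace = lam * d + ∑ i, x i ⬝ᵥ x i := by
    simp [Matrix.trace_add, Matrix.trace_sum, Matrix.trace_vecMulVec]
  have hdet := hpsd.det_le_trace_div_card_pow
  have hnonneg : 0 ≤ (lam • (1 : Matrix (Fin d) (Fin d) ℝ) +
      ∑ i, Matrix.vecMulVec (x i) (x i)).trace / d := div_nonneg hpsd.trace_nonneg hd0.le
  rw [Fintype.card_fin] at hdet
  refine hdet.trans (pow_le_pow_left₀ hnonneg ?_ d)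
  rw [htrace, add_div, mul_div_cancel_right₀ _ hd0.ne']
  gcongr
end

section
/- Let x₁, …, xₙ ∈ ℝ^d be any sequence of vectors. Then det(I_d + Σ_{i=1}^n xᵢxᵢᵀ) ≥ 1 + Σ_{i=1}^n ‖xᵢ‖₂². -/
lemma Finset.one_add_sum_le_prod_one_add_of_nonneg {ι : Type*} (s : Finset ι) {f : ι → ℝ}
    (hf : ∀ i, 0 ≤ f i) : 1 + ∑ i ∈ s, f i ≤ ∏ i ∈ s, (1 + f i) := by
  classical
  induction s using Finset.induction_on with
  | empty => simp
  | insert a s ha ih =>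
    rw [Finset.sum_insert ha, Finset.prod_insert ha]
    nlinarith [mul_le_mul_of_nonneg_left ih (hf a),
      mul_nonneg (hf a) (Finset.sum_nonneg fun i (_ : i ∈ s) => hf i)]

lemma Matrix.IsHermitian.det_one_add_eq_prod {m : Type*} [Fintype m] [DecidableEq m]
    {A : Matrix m m ℝ} (hA : A.IsHermitian) :
    (1 + A).det = ∏ i, (1 + hA.eigenvalues i) := by
  have h := congrArg (Polynomial.eval (-1)) hA.charpoly_eq
  rw [Matrix.eval_charpoly, Polynomial.eval_prod] at h
  have h1 : Matrix.scalar m (-1 : ℝ) - A = -(1 + A) := by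
    rw [map_neg, map_one, neg_add, sub_eq_add_neg]
  have h2 : ∀ i, Polynomial.eval (-1)
      (Polynomial.X - Polynomial.C (hA.eigenvalues i : ℝ)) = -1 * (1 + hA.eigenvalues i) := by
    intro i
    simp only [Polynomial.eval_sub, Polynomial.eval_X, Polynomial.eval_C]
    ring
  rw [h1, Matrix.det_neg] at h
  erw [Finset.prod_congr rfl fun i _ => h2 i] at h
  rw [Finset.prod_mul_distrib, Finset.prod_const, Finset.card_univ] at h
  exact mul_left_cancel₀ (pow_ne_zero _ (by norm_num)) h

lemma Matrix.PosSemidef.one_add_trace_le_det_one_add {m : Type*} [Fintype m] [DecidableEq m]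
    {A : Matrix m m ℝ} (hA : A.PosSemidef) : 1 + A.trace ≤ (1 + A).det := by
  rw [hA.isHermitian.det_one_add_eq_prod, hA.isHermitian.trace_eq_sum_eigenvalues]
  exact Finset.one_add_sum_le_prod_one_add_of_nonneg _ hA.eigenvalues_nonneg

/-- Determinant–norm inequality:
`det(I + Σᵢ xᵢxᵢᵀ) ≥ 1 + Σᵢ ‖xᵢ‖₂²` for any vectors `x₁, …, xₙ ∈ ℝ^d`. -/
theorem det_norm_inequality {d n : ℕ} (x : Fin n → Fin d → ℝ) :
    1 + ∑ i, x i ⬝ᵥ x i ≤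
      ((1 : Matrix (Fin d) (Fin d) ℝ) + ∑ i, Matrix.vecMulVec (x i) (x i)).det := by
  have h : (∑ i, Matrix.vecMulVec (x i) (x i)).PosSemidef :=
    Matrix.posSemidef_sum _ fun i _ => by
      simpa using Matrix.posSemidef_vecMulVec_self_star (x i)
  simpa [Matrix.trace_sum, Matrix.trace_vecMulVec] using h.one_add_trace_le_det_one_add
end

section
/- Let m and K be positive integers, let λ ∈ (0, 2], let p ∈ [0,1]^m be a vector with at most K strictly positive coordinates, let μ ∈ (0,1)^m, and let ζ ∈ ℝ^m. Then Σ_{i=1}^m p_i·|ζ_i| ≤ (√K / 2)·√( Σ_{i=1}^m p_i^λ · ζ_i² / ((1 − μ_i)·μ_i) ). -/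
/-- Since `4 * ((1 - v) * v) ≤ 1` and `x ^ 2 ≤ x ^ a` on the unit interval, a weighted square is
dominated by the corresponding variance-normalised one. -/
theorem four_mul_sq_le_rpow_mul_sq_div {a x v : ℝ} (ha0 : 0 < a) (ha2 : a ≤ 2)
    (hx : x ∈ Set.Icc (0 : ℝ) 1) (hv : v ∈ Set.Ioo (0 : ℝ) 1) (z : ℝ) :
    4 * (x * |z|) ^ 2 ≤ x ^ a * z ^ 2 / ((1 - v) * v) := by
  have hvar : 0 < (1 - v) * v := mul_pos (sub_pos.2 hv.2) hv.1
  have hpow : x ^ 2 ≤ x ^ a := by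
    rw [← Real.rpow_two]
    exact Real.rpow_le_rpow_of_exponent_ge' hx.1 hx.2 ha0.le ha2
  rw [le_div_iff₀ hvar, mul_pow, sq_abs]
  calc 4 * (x ^ 2 * z ^ 2) * ((1 - v) * v)
      = x ^ 2 * z ^ 2 * (4 * ((1 - v) * v)) := by ring
    _ ≤ x ^ 2 * z ^ 2 * 1 := by
        gcongr
        nlinarith [sq_nonneg (2 * v - 1)]
    _ ≤ x ^ a * z ^ 2 := by
        rw [mul_one]
        gcongr

/-- Cauchy–Schwarz step converting 1-norm TPM smoothness into TPVM smoothness: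
if `p ∈ [0,1]^m` has at most `K` strictly positive coordinates, `μ ∈ (0,1)^m`,
and `0 < λ ≤ 2`, then
`Σᵢ pᵢ·|ζᵢ| ≤ (√K/2)·√(Σᵢ pᵢ^λ·ζᵢ²/((1−μᵢ)·μᵢ))`. -/
theorem tpm_to_tpvm_cauchy_schwarz (m K : ℕ) (hm : 0 < m) (hK : 0 < K)
    (lam : ℝ) (hlam0 : 0 < lam) (hlam2 : lam ≤ 2)
    (p : Fin m → ℝ) (hp : ∀ i, p i ∈ Set.Icc (0 : ℝ) 1)
    (hcard : (Finset.univ.filter fun i => 0 < p i).card ≤ K)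
    (μ : Fin m → ℝ) (hμ : ∀ i, μ i ∈ Set.Ioo (0 : ℝ) 1)
    (ζ : Fin m → ℝ) :
    ∑ i, p i * |ζ i| ≤
      (Real.sqrt K / 2) *
        Real.sqrt (∑ i, p i ^ lam * ζ i ^ 2 / ((1 - μ i) * μ i)) := by
  rw [div_mul_eq_mul_div, ← Real.sqrt_mul (Nat.cast_nonneg K), le_div_iff₀ two_pos]
  apply Real.le_sqrt_of_sq_le
  have hsupp : ∑ i with 0 < p i, p i * |ζ i| = ∑ i, p i * |ζ i| := by
    refine Finset.sum_filter_of_ne fun i _ hi => (hp i).1.lt_of_ne' ?_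
    intro h
    simp [h] at hi
  have hcs : (∑ i with 0 < p i, p i * |ζ i|) ^ 2 ≤
      (Finset.univ.filter fun i => 0 < p i).card * ∑ i with 0 < p i, (p i * |ζ i|) ^ 2 :=
    sq_sum_le_card_mul_sum_sq
  rw [← hsupp, mul_pow]
  calc (∑ i with 0 < p i, p i * |ζ i|) ^ 2 * 2 ^ 2
      ≤ ((K : ℝ) * ∑ i, (p i * |ζ i|) ^ 2) * 2 ^ 2 := by
        gcongr
        refine hcs.trans ?_
        gcongr
        exact Finset.filter_subset _ _
    _ = (K : ℝ) * ∑ i, 4 * (p i * |ζ i|) ^ 2 := by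
        rw [← Finset.mul_sum]
        ring
    _ ≤ (K : ℝ) * ∑ i, p i ^ lam * ζ i ^ 2 / ((1 - μ i) * μ i) := by
        gcongr with i
        exact four_mul_sq_le_rpow_mul_sq_div hlam0 hlam2 (hp i) (hμ i) (ζ i)
end
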